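/- Let W be an algebraic Weyl tensor on Euclidean ℝ⁴, not identically zero, with W(e₁,x,y,e₁) = 0 for all x,y ∈ ℝ⁴. Then Ŵ_L commutes with J, and the induced complex-linear operator 𝒲 on the complex vector space (ℝ⁶, i := J) is diagonalizable (there is a complex basis of eigenvectors) and has exactly two or three distinct complex eigenvalues. (Equivalently: W has Petrov Type I or D with respect to the Lorentzian metric obtained by flipping the sign of the e₁-direction; Types II, N, and III cannot occur.) -/

import Mathlib

open scoped BigOperators

/-- Vectors in ℝ⁴. -/
abbrev V4 : Type := Fin 4 → ℝ

/-- ℝ⁶, identified with Λ²ℝ⁴ via the ordered basis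
`e₁∧e₂, e₁∧e₃, e₁∧e₄, e₃∧e₄, e₄∧e₂, e₂∧e₃`. -/
abbrev V6 : Type := Fin 6 → ℝ

/-- Covariant 4-tensors (multilinear maps ℝ⁴×ℝ⁴×ℝ⁴×ℝ⁴ → ℝ). -/
abbrev Tensor4 : Type := MultilinearMap ℝ (fun _ : Fin 4 => V4) ℝ

/-- Evaluation of a 4-tensor on four vectors. -/
def tapp (W : Tensor4) (x y z w : V4) : ℝ := W ![x, y, z, w]

/-- Standard basis of ℝ⁴ (0-indexed: `e 0 = e₁`, …, `e 3 = e₄`). -/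
def e (i : Fin 4) : V4 := Pi.single i 1

/-- Standard basis of ℝ⁶ (0-indexed: `u 0 = u₁`, …, `u 5 = u₆`). -/
def u (c : Fin 6) : V6 := Pi.single c 1

/-- The index pairs of the six coordinate 2-planes
`e₁∧e₂, e₁∧e₃, e₁∧e₄, e₃∧e₄, e₄∧e₂, e₂∧e₃` (0-indexed). -/
def pairs : Fin 6 → Fin 4 × Fin 4 := ![(0,1), (0,2), (0,3), (2,3), (3,1), (1,2)]

/-- The Minkowski inner product `η` on ℝ⁴ (timelike direction `e₁`). -/
def etaR4 (x y : V4) : ℝ := -(x 0 * y 0) + x 1 * y 1 + x 2 * y 2 + x 3 * y 3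

/-- The Lorentzian inner product `⟨·,·⟩_L` on ℝ⁶, of signature (−−−+++). -/
def ipL (ξ η : V6) : ℝ :=
  -(ξ 0 * η 0) - ξ 1 * η 1 - ξ 2 * η 2 + ξ 3 * η 3 + ξ 4 * η 4 + ξ 5 * η 5

/-- The matrix of the Lorentzian Hodge star `J = [[0, I₃],[−I₃, 0]]`. -/
def Jmat : Matrix (Fin 6) (Fin 6) ℝ :=
  !![0,0,0,1,0,0;
     0,0,0,0,1,0;
     0,0,0,0,0,1;
     -1,0,0,0,0,0;
     0,-1,0,0,0,0;
     0,0,-1,0,0,0]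

/-- The Lorentzian Hodge star `J` as a linear map on ℝ⁶. -/
def J : V6 →ₗ[ℝ] V6 := Matrix.toLin' Jmat

/-- The matrix of the Riemannian Hodge star `S = [[0, I₃],[I₃, 0]]`. -/
def Smat : Matrix (Fin 6) (Fin 6) ℝ :=
  !![0,0,0,1,0,0;
     0,0,0,0,1,0;
     0,0,0,0,0,1;
     1,0,0,0,0,0;
     0,1,0,0,0,0;
     0,0,1,0,0,0]

/-- The Riemannian Hodge star `S` as a linear map on ℝ⁶. -/
def S : V6 →ₗ[ℝ] V6 := Matrix.toLin' Smat

/-- `W` is an algebraic Weyl tensor on Euclidean ℝ⁴. -/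
def IsWeylE (W : Tensor4) : Prop :=
  (∀ x y z w, tapp W x y z w = - tapp W y x z w) ∧
  (∀ x y z w, tapp W x y z w = - tapp W x y w z) ∧
  (∀ x y z w, tapp W x y z w = tapp W z w x y) ∧
  (∀ x y z w, tapp W x y z w + tapp W y z x w + tapp W z x y w = 0) ∧
  (∀ x y, ∑ i : Fin 4, tapp W (e i) x y (e i) = 0)

/-- `W` is an algebraic Weyl tensor on Minkowski ℝ⁴ (η-trace-free). -/
def IsWeylM (W : Tensor4) : Prop :=
  (∀ x y z w, tapp W x y z w = - tapp W y x z w) ∧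
  (∀ x y z w, tapp W x y z w = - tapp W x y w z) ∧
  (∀ x y z w, tapp W x y z w = tapp W z w x y) ∧
  (∀ x y z w, tapp W x y z w + tapp W y z x w + tapp W z x y w = 0) ∧
  (∀ x y, -(tapp W (e 0) x y (e 0)) + tapp W (e 1) x y (e 1)
      + tapp W (e 2) x y (e 2) + tapp W (e 3) x y (e 3) = 0)

/-- `WL` is the Lorentzian Weyl operator of `W`:
`⟨WL u_c, u_r⟩_L = W(e_{i(c)}, e_{j(c)}, e_{i(r)}, e_{j(r)})`. -/
def IsLorentzWeylOp (W : Tensor4) (WL : V6 →ₗ[ℝ] V6) : Prop :=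
  ∀ c r : Fin 6,
    ipL (WL (u c)) (u r) =
      tapp W (e (pairs c).1) (e (pairs c).2) (e (pairs r).1) (e (pairs r).2)

/-- `Wg` is the Riemannian Weyl operator of `W`:
`⟨Wg u_c, u_r⟩ = W(e_{i(c)}, e_{j(c)}, e_{i(r)}, e_{j(r)})` w.r.t. the dot product. -/
def IsRiemWeylOp (W : Tensor4) (Wg : V6 →ₗ[ℝ] V6) : Prop :=
  ∀ c r : Fin 6,
    (∑ i : Fin 6, Wg (u c) i * u r i) =
      tapp W (e (pairs c).1) (e (pairs c).2) (e (pairs r).1) (e (pairs r).2)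

/-- `ξ` is an eigenvector of the complex-linear operator `𝒲` induced by `WL` on
`(ℝ⁶, i := J)`, with complex eigenvalue `a + bi`. -/
def IsCEigen (WL : V6 →ₗ[ℝ] V6) (a b : ℝ) (ξ : V6) : Prop :=
  ξ ≠ 0 ∧ WL ξ = a • ξ + b • J ξ

/-- The set of complex eigenvalues of `𝒲`, recorded as pairs `(a, b) ∈ ℝ × ℝ`
standing for `a + bi`. -/
def cSpectrum (WL : V6 →ₗ[ℝ] V6) : Set (ℝ × ℝ) :=
  {z | ∃ ξ : V6, IsCEigen WL z.1 z.2 ξ}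

/-- `𝒲` is diagonalizable: there is a complex basis `ξ₁, ξ₂, ξ₃` of `(ℝ⁶, i := J)`
consisting of eigenvectors, i.e. `ξ₁, Jξ₁, ξ₂, Jξ₂, ξ₃, Jξ₃` is a real basis of ℝ⁶. -/
def HasEigenBasis (WL : V6 →ₗ[ℝ] V6) : Prop :=
  ∃ (a b : Fin 3 → ℝ) (ξ : Fin 3 → V6),
    (∀ i, IsCEigen WL (a i) (b i) (ξ i)) ∧
    LinearIndependent ℝ ![ξ 0, J (ξ 0), ξ 1, J (ξ 1), ξ 2, J (ξ 2)] ∧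
    Submodule.span ℝ (Set.range ![ξ 0, J (ξ 0), ξ 1, J (ξ 1), ξ 2, J (ξ 2)]) = ⊤

/-- The vector of ℝ⁶ with electric part `p` and magnetic part `q`. -/
def ofParts (p q : Fin 3 → ℝ) : V6 := ![p 0, p 1, p 2, q 0, q 1, q 2]

theorem exists_eq_ofParts (ξ : V6) : ∃ p q, ξ = ofParts p q :=
  ⟨![ξ 0, ξ 1, ξ 2], ![ξ 3, ξ 4, ξ 5], by ext i; fin_cases i <;> rfl⟩

theorem ofParts_inj {p q p' q' : Fin 3 → ℝ} :
    ofParts p q = ofParts p' q' ↔ p = p' ∧ q = q' := by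
  simp only [funext_iff, Fin.forall_fin_succ, ofParts]
  simp [and_assoc]

theorem ofParts_eq_zero {p q : Fin 3 → ℝ} : ofParts p q = 0 ↔ p = 0 ∧ q = 0 := by
  rw [← ofParts_inj]
  suffices h : ofParts 0 0 = 0 by rw [h]
  ext i; fin_cases i <;> rfl

theorem ofParts_add (p q p' q' : Fin 3 → ℝ) :
    ofParts p q + ofParts p' q' = ofParts (p + p') (q + q') := by
  ext i; fin_cases i <;> rfl

theorem smul_ofParts (a : ℝ) (p q : Fin 3 → ℝ) :
    a • ofParts p q = ofParts (a • p) (a • q) := by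
  ext i; fin_cases i <;> rfl

theorem ofParts_castAdd (p q : Fin 3 → ℝ) (i : Fin 3) : ofParts p q (Fin.castAdd 3 i) = p i := by
  fin_cases i <;> rfl

theorem ofParts_natAdd (p q : Fin 3 → ℝ) (i : Fin 3) : ofParts p q (Fin.natAdd 3 i) = q i := by
  fin_cases i <;> rfl

theorem J_ofParts (p q : Fin 3 → ℝ) : J (ofParts p q) = ofParts q (-p) := by
  ext i
  fin_cases i <;>
    simp [J, Jmat, ofParts, Matrix.mulVec, dotProduct, Fin.sum_univ_succ]

section SymmetricBlock

open Matrix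

variable {WL : V6 →ₗ[ℝ] V6} {B : Matrix (Fin 3) (Fin 3) ℝ}

/-- An operator of the form `-i B`, with `B` a real matrix, is complex linear. -/
theorem comp_J_of_block (hWL : ∀ p q, WL (ofParts p q) = ofParts (-(B *ᵥ q)) (B *ᵥ p)) :
    WL.comp J = J.comp WL := by
  refine LinearMap.ext fun ξ => ?_
  obtain ⟨p, q, rfl⟩ := exists_eq_ofParts ξ
  simp [J_ofParts, hWL, mulVec_neg]

theorem linearIndependent_ofParts {v : Fin 3 → Fin 3 → ℝ} (hv : LinearIndependent ℝ v) :
    LinearIndependent ℝ ![ofParts (v 0) 0, J (ofParts (v 0) 0), ofParts (v 1) 0,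
      J (ofParts (v 1) 0), ofParts (v 2) 0, J (ofParts (v 2) 0)] := by
  rw [Fintype.linearIndependent_iff] at hv ⊢
  intro g hg
  simp only [Fin.sum_univ_six, J_ofParts] at hg
  simp [smul_ofParts, ofParts_add, ofParts_eq_zero] at hg
  have h₁ := hv ![g 0, g 2, g 4] (by simpa [Fin.sum_univ_three] using hg.1)
  have h₂ := hv ![-g 1, -g 3, -g 5] (by simpa [Fin.sum_univ_three] using hg.2)
  simp [Fin.forall_fin_succ] at h₁ h₂
  simp [Fin.forall_fin_succ, h₁, h₂]

theorem hasEigenBasis_of_block (hB : B.IsHermitian)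
    (hWL : ∀ p q, WL (ofParts p q) = ofParts (-(B *ᵥ q)) (B *ᵥ p)) : HasEigenBasis WL := by
  let v : Fin 3 → Fin 3 → ℝ := fun i => hB.eigenvectorBasis i
  have hv : LinearIndependent ℝ v :=
    hB.eigenvectorBasis.orthonormal.linearIndependent.map'
      (WithLp.linearEquiv 2 ℝ (Fin 3 → ℝ)).toLinearMap (LinearEquiv.ker _)
  have hli := linearIndependent_ofParts hv
  refine ⟨0, fun i => -hB.eigenvalues i, fun i => ofParts (v i) 0, fun i => ⟨?_, ?_⟩, hli,
    hli.span_eq_top_of_card_eq_finrank' (by simp)⟩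
  · simpa [ofParts_eq_zero] using hv.ne_zero i
  · have h : B *ᵥ v i = hB.eigenvalues i • v i := hB.mulVec_eigenvectorBasis i
    simp [hWL, J_ofParts, smul_ofParts, h, -neg_smul, neg_smul (hB.eigenvalues i) (v i)]

theorem mem_spectrum_of_mulVec_eq_smul {p : Fin 3 → ℝ} {μ : ℝ} (hp : p ≠ 0)
    (h : B *ᵥ p = μ • p) : μ ∈ spectrum ℝ B := by
  rw [← Matrix.spectrum_toLin', ← Module.End.hasEigenvalue_iff_mem_spectrum]
  exact Module.End.hasEigenvalue_of_hasEigenvector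
    ⟨Module.End.mem_eigenspace_iff.2 (by simpa using h), hp⟩

/-- The eigenvalues of `-i B`, with `B` real symmetric, are `-i λ` for `λ` in the spectrum of
`B`. -/
theorem cSpectrum_of_block (hB : B.IsHermitian)
    (hWL : ∀ p q, WL (ofParts p q) = ofParts (-(B *ᵥ q)) (B *ᵥ p)) :
    cSpectrum WL = (fun t : ℝ => ((0, -t) : ℝ × ℝ)) '' spectrum ℝ B := by
  ext ⟨a, b⟩
  constructor
  · rintro ⟨ξ, hξ, h⟩
    obtain ⟨p, q, rfl⟩ := exists_eq_ofParts ξ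
    simp only [hWL, J_ofParts, smul_ofParts, ofParts_add, ofParts_inj] at h
    obtain ⟨hq, hp⟩ := h
    have hpq : ¬ (p = 0 ∧ q = 0) := fun h => hξ (ofParts_eq_zero.2 h)
    have hsymm : q ⬝ᵥ B *ᵥ p = p ⬝ᵥ B *ᵥ q := by
      rw [dotProduct_mulVec, ← mulVec_transpose, dotProduct_comm,
        show Bᵀ = B by simpa [IsHermitian] using hB]
    have hq' : B *ᵥ q = -(a • p + b • q) := by rw [← hq, neg_neg]
    have ha : a = 0 := by
      rw [hp, hq'] at hsymm
      simp only [dotProduct_add, dotProduct_smul, dotProduct_neg, smul_eq_mul,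
        dotProduct_comm q p] at hsymm
      have h₁ : a * (p ⬝ᵥ p + q ⬝ᵥ q) = 0 := by linarith
      refine (mul_eq_zero.1 h₁).resolve_right fun h₂ => hpq ?_
      have hp₀ := dotProduct_self_star_nonneg p
      have hq₀ := dotProduct_self_star_nonneg q
      simp only [star_trivial] at hp₀ hq₀
      exact ⟨dotProduct_self_eq_zero.1 (by linarith), dotProduct_self_eq_zero.1 (by linarith)⟩
    subst ha
    refine ⟨-b, ?_, by simp⟩
    by_cases h₀ : p = 0
    · exact mem_spectrum_of_mulVec_eq_smul (fun h => hpq ⟨h₀, h⟩) (by simpa using hq')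
    · exact mem_spectrum_of_mulVec_eq_smul h₀ (by simpa using hp)
  · rintro ⟨t, ht, h⟩
    obtain ⟨rfl, rfl⟩ := Prod.mk.inj h
    rw [← Matrix.spectrum_toLin', ← Module.End.hasEigenvalue_iff_mem_spectrum] at ht
    obtain ⟨p, hp⟩ := ht.exists_hasEigenvector
    have hBp : B *ᵥ p = t • p := by simpa using hp.apply_eq_smul
    exact ⟨ofParts p 0, fun h => hp.2 (ofParts_eq_zero.1 h).1,
      by simp [hWL, J_ofParts, smul_ofParts, hBp, -neg_smul, neg_smul t p]⟩

/-- A nonzero trace-free real symmetric `3 × 3` matrix has two or three distinct eigenvalues. -/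
theorem ncard_spectrum_of_trace_eq_zero (hB : B.IsHermitian) (htr : B.trace = 0) (h₀ : B ≠ 0) :
    (spectrum ℝ B).ncard = 2 ∨ (spectrum ℝ B).ncard = 3 := by
  rw [hB.spectrum_real_eq_range_eigenvalues]
  have hfin : (Set.range hB.eigenvalues).Finite := Set.finite_range _
  have hle : (Set.range hB.eigenvalues).ncard ≤ 3 := by
    rw [← Set.image_univ]
    exact (Set.ncard_image_le Set.finite_univ).trans (by simp [Set.ncard_univ])
  have hpos : (Set.range hB.eigenvalues).ncard ≠ 0 := by
    rw [Ne, Set.ncard_eq_zero hfin]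
    exact (Set.range_nonempty _).ne_empty
  have hne : (Set.range hB.eigenvalues).ncard ≠ 1 := by
    intro h
    obtain ⟨c, hc⟩ := Set.ncard_eq_one.1 h
    have hall : ∀ i, hB.eigenvalues i = c := fun i => by
      have : hB.eigenvalues i ∈ Set.range hB.eigenvalues := ⟨i, rfl⟩
      simpa [hc] using this
    have hsum := hB.trace_eq_sum_eigenvalues
    simp only [htr, hall] at hsum
    have hc₀ : c = 0 := by simpa using hsum
    exact h₀ (hB.eigenvalues_eq_zero_iff.1 (funext fun i => by simp [hall, hc₀]))
  omega

end SymmetricBlock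

/-- A 4-tensor with the pair antisymmetries vanishes as soon as it vanishes on coordinate
2-planes. -/
theorem eq_zero_of_pairs {W : Tensor4}
    (h₁ : ∀ x y z w, tapp W x y z w = -tapp W y x z w)
    (h₂ : ∀ x y z w, tapp W x y z w = -tapp W x y w z)
    (h : ∀ c r : Fin 6,
      tapp W (e (pairs c).1) (e (pairs c).2) (e (pairs r).1) (e (pairs r).2) = 0) :
    W = 0 := by
  have hpair : ∀ i j : Fin 4, i = j ∨ ∃ c, pairs c = (i, j) ∨ pairs c = (j, i) := by decide
  have hright : ∀ (c : Fin 6) (k l : Fin 4),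
      tapp W (e (pairs c).1) (e (pairs c).2) (e k) (e l) = 0 := by
    intro c k l
    obtain rfl | ⟨r, hr | hr⟩ := hpair k l
    · linarith [h₂ (e (pairs c).1) (e (pairs c).2) (e k) (e k)]
    · simpa [hr] using h c r
    · rw [h₂]
      simpa [hr] using h c r
  have hall : ∀ i j k l : Fin 4, tapp W (e i) (e j) (e k) (e l) = 0 := by
    intro i j k l
    obtain rfl | ⟨c, hc | hc⟩ := hpair i j
    · linarith [h₁ (e i) (e i) (e k) (e l)]
    · simpa [hc] using hright c k l
    · rw [h₁]
      simpa [hc] using hright c k l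
  refine Module.Basis.ext_multilinear (fun _ => Pi.basisFun ℝ (Fin 4)) fun v => ?_
  have hv := hall (v 0) (v 1) (v 2) (v 3)
  rw [tapp] at hv
  rw [zero_apply, ← hv]
  congr 1
  ext1 i
  fin_cases i <;> simp [e]

theorem lorentzWeylOp_apply {W : Tensor4} {WL : V6 →ₗ[ℝ] V6} (hWL : IsLorentzWeylOp W WL)
    (ξ : V6) (r : Fin 6) :
    WL ξ r = (if r < 3 then -1 else 1) * ∑ c, ξ c *
      tapp W (e (pairs c).1) (e (pairs c).2) (e (pairs r).1) (e (pairs r).2) := by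
  have hu : ∀ c, WL (u c) r = (if r < 3 then -1 else 1) *
      tapp W (e (pairs c).1) (e (pairs c).2) (e (pairs r).1) (e (pairs r).2) := by
    intro c
    rw [← hWL c r]
    fin_cases r <;> simp [ipL, u]
  have hξ : ξ = ∑ c, ξ c • u c := by
    simpa [u] using (pi_eq_sum_univ' ξ)
  conv_lhs => rw [hξ]
  simp only [map_sum, map_smul, Finset.sum_apply, Pi.smul_apply, smul_eq_mul, hu, Finset.mul_sum]
  exact Finset.sum_congr rfl fun c _ => by ring

/-- The off-diagonal block of the curvature operator of `W`, pairing the planes `e₁ ∧ eᵢ` with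
their Hodge duals. -/
def magneticBlock (W : Tensor4) : Matrix (Fin 3) (Fin 3) ℝ :=
  Matrix.of fun i j => tapp W (e 0) (e i.succ) (e (pairs (Fin.natAdd 3 j)).1)
    (e (pairs (Fin.natAdd 3 j)).2)

theorem magneticBlock_isHermitian {W : Tensor4} (hW : IsWeylE W)
    (hT : ∀ x y : V4, tapp W (e 0) x y (e 0) = 0) : (magneticBlock W).IsHermitian := by
  obtain ⟨h₁, h₂, -, -, h₅⟩ := hW
  simp only [Fin.sum_univ_four, hT, zero_add] at h₅
  have key₁ := h₅ (e 0) (e 1)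
  have key₂ := h₅ (e 0) (e 2)
  have key₃ := h₅ (e 0) (e 3)
  have hself' : ∀ x y z, tapp W x y z z = 0 := fun x y z => by linarith [h₂ x y z z]
  simp only [hself', add_zero, zero_add] at key₁ key₂ key₃
  refine Matrix.IsHermitian.ext fun i j => ?_
  fin_cases i <;> fin_cases j <;> simp [magneticBlock, pairs] <;>
    linarith [h₁ (e 1) (e 0) (e 2) (e 1), h₁ (e 1) (e 0) (e 3) (e 1), h₁ (e 2) (e 0) (e 1) (e 2),
      h₁ (e 2) (e 0) (e 3) (e 2), h₁ (e 3) (e 0) (e 1) (e 3), h₁ (e 3) (e 0) (e 2) (e 3),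
      h₂ (e 0) (e 1) (e 2) (e 1), h₂ (e 0) (e 2) (e 3) (e 2), h₂ (e 0) (e 3) (e 1) (e 3)]

theorem magneticBlock_trace {W : Tensor4} (hW : IsWeylE W) : (magneticBlock W).trace = 0 := by
  obtain ⟨-, h₂, h₃, h₄, -⟩ := hW
  simp [Matrix.trace, Fin.sum_univ_three, magneticBlock, pairs]
  linarith [h₄ (e 1) (e 2) (e 3) (e 0), h₃ (e 0) (e 1) (e 2) (e 3), h₃ (e 0) (e 2) (e 3) (e 1),
    h₃ (e 0) (e 3) (e 1) (e 2), h₂ (e 2) (e 3) (e 0) (e 1), h₂ (e 3) (e 1) (e 0) (e 2),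
    h₂ (e 1) (e 2) (e 0) (e 3)]

/-- Components on two planes both containing `e₁` vanish. -/
theorem tapp_electric {W : Tensor4} (hW : IsWeylE W)
    (hT : ∀ x y : V4, tapp W (e 0) x y (e 0) = 0) (x y : V4) :
    tapp W (e 0) x (e 0) y = 0 := by
  rw [hW.2.1, hT, neg_zero]

/-- Components on two planes both orthogonal to `e₁` vanish: in dimension three the Ricci
tensor determines the curvature. -/
theorem tapp_spatial {W : Tensor4} (hW : IsWeylE W)
    (hT : ∀ x y : V4, tapp W (e 0) x y (e 0) = 0) (c r : Fin 3) :
    tapp W (e (pairs (Fin.natAdd 3 c)).1) (e (pairs (Fin.natAdd 3 c)).2)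
      (e (pairs (Fin.natAdd 3 r)).1) (e (pairs (Fin.natAdd 3 r)).2) = 0 := by
  obtain ⟨h₁, h₂, -, -, h₅⟩ := hW
  simp only [Fin.sum_univ_four, hT, zero_add] at h₅
  have hself : ∀ x z w, tapp W x x z w = 0 := fun x z w => by linarith [h₁ x x z w]
  have hself' : ∀ x y z, tapp W x y z z = 0 := fun x y z => by linarith [h₂ x y z z]
  have swap : ∀ x y z w, tapp W x y z w = tapp W y x w z := fun x y z w => by
    rw [h₁, h₂, neg_neg]
  have ric₁₁ := h₅ (e 1) (e 1)
  have ric₂₂ := h₅ (e 2) (e 2)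
  have ric₃₃ := h₅ (e 3) (e 3)
  have ric₁₂ := h₅ (e 1) (e 2)
  have ric₁₃ := h₅ (e 1) (e 3)
  have ric₂₃ := h₅ (e 2) (e 3)
  have ric₂₁ := h₅ (e 2) (e 1)
  have ric₃₁ := h₅ (e 3) (e 1)
  have ric₃₂ := h₅ (e 3) (e 2)
  simp only [hself, hself', add_zero, zero_add] at ric₁₁ ric₂₂ ric₃₃ ric₁₂ ric₁₃ ric₂₃
  simp only [hself, hself', add_zero, zero_add] at ric₂₁ ric₃₁ ric₃₂
  fin_cases c <;> fin_cases r <;> simp [pairs] <;>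
    linarith [h₂ (e 2) (e 3) (e 2) (e 3), h₂ (e 3) (e 1) (e 3) (e 1), h₂ (e 1) (e 2) (e 1) (e 2),
      swap (e 1) (e 2) (e 2) (e 1), swap (e 1) (e 3) (e 3) (e 1), swap (e 2) (e 3) (e 3) (e 2),
      swap (e 2) (e 3) (e 3) (e 1), swap (e 3) (e 1) (e 1) (e 2), swap (e 1) (e 2) (e 2) (e 3)]

theorem pairs_castAdd (i : Fin 3) : pairs (Fin.castAdd 3 i) = (0, i.succ) := by
  decide +revert

theorem lorentzWeylOp_ofParts {W : Tensor4} {WL : V6 →ₗ[ℝ] V6} (hW : IsWeylE W)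
    (hWL : IsLorentzWeylOp W WL) (hT : ∀ x y : V4, tapp W (e 0) x y (e 0) = 0)
    (p q : Fin 3 → ℝ) :
    WL (ofParts p q) =
      ofParts (-((magneticBlock W).mulVec q)) ((magneticBlock W).mulVec p) := by
  have hsymm := (magneticBlock_isHermitian hW hT).apply
  have hsum : ∀ f : Fin 6 → ℝ,
      ∑ c, f c = ∑ i : Fin 3, f (Fin.castAdd 3 i) + ∑ i : Fin 3, f (Fin.natAdd 3 i) :=
    Fin.sum_univ_add (a := 3) (b := 3)
  ext r
  rw [lorentzWeylOp_apply hWL, hsum]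
  refine Fin.addCases (m := 3) (n := 3) (fun j => ?_) (fun j => ?_) r
  · have hj : Fin.castAdd 3 j < (3 : Fin 6) := by decide +revert
    rw [if_pos hj]
    simp only [ofParts_castAdd, ofParts_natAdd, pairs_castAdd, tapp_electric hW hT, mul_zero,
      Finset.sum_const_zero, zero_add, neg_one_mul, Pi.neg_apply, Matrix.mulVec, dotProduct]
    refine congrArg _ (Finset.sum_congr rfl fun i _ => ?_)
    rw [hW.2.2.1, mul_comm]
    rfl
  · have hj : ¬ Fin.natAdd 3 j < (3 : Fin 6) := by decide +revert
    rw [if_neg hj]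
    simp only [ofParts_castAdd, ofParts_natAdd, pairs_castAdd, tapp_spatial hW hT, mul_zero,
      Finset.sum_const_zero, add_zero, one_mul, Matrix.mulVec, dotProduct]
    refine Finset.sum_congr rfl fun i _ => ?_
    rw [← hsymm, star_trivial, mul_comm]
    rfl

theorem magneticBlock_ne_zero {W : Tensor4} (hW : IsWeylE W) (hne : W ≠ 0)
    (hT : ∀ x y : V4, tapp W (e 0) x y (e 0) = 0) : magneticBlock W ≠ 0 := by
  intro h
  have hB : ∀ i j, magneticBlock W i j = 0 := fun i j => by rw [h]; rfl
  refine hne (eq_zero_of_pairs hW.1 hW.2.1 fun c r => ?_)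
  refine Fin.addCases (m := 3) (n := 3) (fun i => ?_) (fun i => ?_) c <;>
    refine Fin.addCases (m := 3) (n := 3) (fun j => ?_) (fun j => ?_) r
  · rw [pairs_castAdd, pairs_castAdd]
    exact tapp_electric hW hT _ _
  · rw [pairs_castAdd]
    exact hB i j
  · rw [hW.2.2.1, pairs_castAdd]
    exact hB j i
  · exact tapp_spatial hW hT i j

/-- Theorem `thm:onlyI`: if a nonzero algebraic Weyl tensor on
Euclidean ℝ⁴ satisfies `W(e₁,·,·,e₁) = 0`, then `Ŵ_L` commutes with `J`, the
induced complex operator `𝒲` is diagonalizable, and it has exactly two or three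
distinct complex eigenvalues (Petrov Type I or D; Types II, N, III cannot occur). -/
theorem stmt11 (W : Tensor4) (WL : V6 →ₗ[ℝ] V6)
    (hW : IsWeylE W) (hne : W ≠ 0) (hWL : IsLorentzWeylOp W WL)
    (hT : ∀ x y : V4, tapp W (e 0) x y (e 0) = 0) :
    WL.comp J = J.comp WL ∧ HasEigenBasis WL ∧
      ((cSpectrum WL).ncard = 2 ∨ (cSpectrum WL).ncard = 3) := by
  have hblock := lorentzWeylOp_ofParts hW hWL hT
  have hB := magneticBlock_isHermitian hW hT
  refine ⟨comp_J_of_block hblock, hasEigenBasis_of_block hB hblock, ?_⟩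
  rw [cSpectrum_of_block hB hblock, Set.ncard_image_of_injective _ fun s t h => by simpa using h]
  exact ncard_spectrum_of_trace_eq_zero hB (magneticBlock_trace hW)
    (magneticBlock_ne_zero hW hne hT)
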